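/- arXiv:1909.07700 — 6 statements merged into one kernel-verified Lean document; each statement's English description precedes it below -/
import Mathlib

section
/- Let (Ω, F, P) be a probability space, N ≥ 1, and let W : Ω → ℂ^{N×N} be a measurable random matrix such that W(ω) is Hermitian positive semidefinite for P-almost every ω. Let λ(ω) := λ_max(W(ω)) be measurable and integrable, and let P_peak > 0 and t ≥ 0. Then for every measurable transmission signal x̄ : Ω → ℂ^N satisfying ‖x̄(ω)‖² ≤ P_peak almost everywhere (peak power constraint) and E[‖x̄‖²] ≤ P_peak · P(λ ≥ t) (average power constraint), the expected received power satisfies E[x̄(ω)^H W(ω) x̄(ω)] ≤ P_peak · E[λ · 1{λ ≥ t}]. In words (Theorem 1 of the paper): no policy satisfying the peak and average power constraints can deliver more average received power than the two-level threshold policy that transmits at full power P_peak along the top eigenvector of W whenever λ_max(W) exceeds the threshold t, and is silent otherwise. -/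
open MeasureTheory Matrix
open scoped ComplexOrder

/-- The Rayleigh quotient of a Hermitian matrix is at most any upper bound of its eigenvalues. -/
theorem Matrix.IsHermitian.re_dotProduct_mulVec_le {n : Type*} [Fintype n] [DecidableEq n]
    {A : Matrix n n ℂ} (hA : A.IsHermitian) {c : ℝ} (hc : ∀ i, hA.eigenvalues i ≤ c)
    (v : n → ℂ) : (star v ⬝ᵥ (A *ᵥ v)).re ≤ c * ∑ i, ‖v i‖ ^ 2 := by
  set U : Matrix n n ℂ := (hA.eigenvectorUnitary : Matrix n n ℂ)
  have hUU : U * Uᴴ = 1 := Unitary.mul_star_self_of_mem hA.eigenvectorUnitary.2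
  have hspec : A = U * diagonal (fun i => (hA.eigenvalues i : ℂ)) * Uᴴ := by
    conv_lhs => rw [hA.spectral_theorem]
    rfl
  have hdiag : diagonal (fun i => ((c - hA.eigenvalues i : ℝ) : ℂ))
      = (c : ℂ) • (1 : Matrix n n ℂ) - diagonal (fun i => (hA.eigenvalues i : ℂ)) := by
    ext i j
    by_cases hij : i = j
    · subst hij; simp
    · simp [hij]
  have hpsd : ((c : ℂ) • (1 : Matrix n n ℂ) - A).PosSemidef := by
    have h : (diagonal (fun i => ((c - hA.eigenvalues i : ℝ) : ℂ))).PosSemidef :=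
      PosSemidef.diagonal fun i => by
        simpa only [Pi.zero_apply, Complex.zero_le_real, sub_nonneg] using hc i
    have h' := h.mul_mul_conjTranspose_same U
    rwa [hdiag, mul_sub, sub_mul, ← hspec, mul_smul_comm, smul_mul_assoc, mul_one, hUU] at h'
  have h := (Complex.le_def.1 (hpsd.dotProduct_mulVec_nonneg v)).1
  have hnorm : star v ⬝ᵥ v = ((∑ i, ‖v i‖ ^ 2 : ℝ) : ℂ) := by
    simp [dotProduct, Complex.conj_mul']
  rw [sub_mulVec, dotProduct_sub, smul_mulVec, one_mulVec, dotProduct_smul, hnorm, smul_eq_mul,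
    ← Complex.ofReal_mul, Complex.sub_re, Complex.ofReal_re, Complex.zero_re] at h
  linarith

/-- Theorem 1 (optimality of the two-level threshold WPT policy): no
transmission signal `x̄` satisfying the peak power constraint
`‖x̄‖² ≤ P_peak` a.e. and the average power constraint
`E[‖x̄‖²] ≤ P_peak · P(λ_max ≥ t)` can deliver more average received power
`E[x̄ᴴ W x̄]` than `P_peak · E[λ_max · 1{λ_max ≥ t}]`, the value achieved by
transmitting at full power along the top eigenvector whenever
`λ_max(W) ≥ t`. -/
theorem stmt_0 {Ω : Type*} [MeasurableSpace Ω] (P : Measure Ω) [IsProbabilityMeasure P]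
    (N : ℕ) (hN : 0 < N)
    (W : Ω → Matrix (Fin N) (Fin N) ℂ)
    (hWmeas : ∀ i j, Measurable fun ω => W ω i j)
    (hWpsd : ∀ᵐ ω ∂P, (W ω).PosSemidef)
    (lam : Ω → ℝ) (hlam_meas : Measurable lam) (hlam_int : Integrable lam P)
    (hlam : ∀ᵐ ω ∂P, ∀ h : (W ω).IsHermitian, lam ω = ⨆ i, h.eigenvalues i)
    (Ppeak t : ℝ) (hPpeak : 0 < Ppeak) (ht : 0 ≤ t)
    (x : Ω → Fin N → ℂ) (hx_meas : Measurable x)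
    (hx_peak : ∀ᵐ ω ∂P, ∑ i, ‖x ω i‖ ^ 2 ≤ Ppeak)
    (hx_avg : ∫ ω, ∑ i, ‖x ω i‖ ^ 2 ∂P ≤ Ppeak * (P {ω | t ≤ lam ω}).toReal) :
    ∫ ω, (star (x ω) ⬝ᵥ (W ω *ᵥ x ω)).re ∂P
      ≤ Ppeak * ∫ ω in {ω | t ≤ lam ω}, lam ω ∂P := by
  set S : Set Ω := {ω | t ≤ lam ω}
  set s : Ω → ℝ := fun ω => ∑ i, ‖x ω i‖ ^ 2
  have hSm : MeasurableSet S := measurableSet_le measurable_const hlam_meas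
  have hs0 (ω : Ω) : 0 ≤ s ω := Finset.sum_nonneg fun i _ => by positivity
  have hs_int : Integrable s P := by
    refine Integrable.of_bound (C := Ppeak) (Measurable.aestronglyMeasurable ?_) ?_
    · fun_prop
    · filter_upwards [hx_peak] with ω h
      rwa [Real.norm_of_nonneg (hs0 ω)]
  have hlamS : Integrable (S.indicator lam) P := hlam_int.indicator hSm
  have honeS : Integrable (S.indicator fun _ => (1 : ℝ)) P := (integrable_const 1).indicator hSm
  have hdiff : Integrable (fun ω => s ω - Ppeak * S.indicator (fun _ => 1) ω) P :=
    hs_int.sub (honeS.const_mul _)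
  calc ∫ ω, (star (x ω) ⬝ᵥ (W ω *ᵥ x ω)).re ∂P
      ≤ ∫ ω, (Ppeak * S.indicator lam ω
          + t * (s ω - Ppeak * S.indicator (fun _ => 1) ω)) ∂P := by
        refine integral_mono_of_nonneg ?_ ((hlamS.const_mul _).add (hdiff.const_mul _)) ?_
        · filter_upwards [hWpsd] with ω h
          exact (Complex.le_def.1 (h.dotProduct_mulVec_nonneg (x ω))).1
        · filter_upwards [hWpsd, hlam, hx_peak] with ω hW hl hp
          have hq : (star (x ω) ⬝ᵥ (W ω *ᵥ x ω)).re ≤ lam ω * s ω :=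
            hW.1.re_dotProduct_mulVec_le
              (fun i => hl hW.1 ▸ le_ciSup (Set.finite_range _).bddAbove i) _
          refine hq.trans ?_
          by_cases hω : ω ∈ S
          · have hω' : t ≤ lam ω := hω
            simp only [Set.indicator_of_mem hω]
            nlinarith [mul_nonneg (sub_nonneg.2 hω') (sub_nonneg.2 hp)]
          · have hω' : lam ω ≤ t := (not_le.1 hω).le
            simp only [Set.indicator_of_notMem hω]
            nlinarith [mul_le_mul_of_nonneg_right hω' (hs0 ω)]
    _ = Ppeak * ∫ ω in S, lam ω ∂P + t * (∫ ω, s ω ∂P - Ppeak * (P S).toReal) := by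
        rw [integral_add (hlamS.const_mul _) (hdiff.const_mul _), integral_const_mul,
          integral_const_mul, integral_sub hs_int (honeS.const_mul _), integral_const_mul,
          integral_indicator hSm, integral_indicator_const _ hSm, smul_eq_mul, mul_one,
          measureReal_def]
    _ ≤ Ppeak * ∫ ω in S, lam ω ∂P :=
        add_le_of_nonpos_right (mul_nonpos_of_nonneg_of_nonpos ht (sub_nonpos.2 hx_avg))
end

section
/- Let (Ω, F, P) be a probability space, λ : Ω → ℝ a nonnegative integrable random variable, P_peak > 0 and t ≥ 0. Define the threshold policy P* := P_peak · 1{λ ≥ t}. Then for every measurable P̄ : Ω → ℝ with 0 ≤ P̄(ω) ≤ P_peak almost everywhere and E[P̄] ≤ E[P*] (= P_peak · P(λ ≥ t)), one has E[λ · P̄] ≤ E[λ · P*]. That is, among all random transmission power levels bounded by P_peak whose mean does not exceed the mean of the threshold policy, the threshold policy maximizes the expected product E[λ · P]. -/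
open MeasureTheory

/-- Among all random transmission power levels `P̄` bounded by `P_peak` whose
mean does not exceed the mean of the threshold policy
`P* = P_peak · 1{λ ≥ t}`, the threshold policy maximizes `E[λ·P]`. -/
theorem stmt_1 {Ω : Type*} [MeasurableSpace Ω] (P : Measure Ω) [IsProbabilityMeasure P]
    (lam : Ω → ℝ) (hlam_meas : Measurable lam) (hlam_nonneg : ∀ ω, 0 ≤ lam ω)
    (hlam_int : Integrable lam P)
    (Ppeak t : ℝ) (hPpeak : 0 < Ppeak) (ht : 0 ≤ t)
    (Pbar : Ω → ℝ) (hPbar_meas : Measurable Pbar)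
    (hPbar_bd : ∀ᵐ ω ∂P, 0 ≤ Pbar ω ∧ Pbar ω ≤ Ppeak)
    (havg : ∫ ω, Pbar ω ∂P
        ≤ ∫ ω, Set.indicator {ω' | t ≤ lam ω'} (fun _ => Ppeak) ω ∂P) :
    ∫ ω, lam ω * Pbar ω ∂P
      ≤ ∫ ω, lam ω * Set.indicator {ω' | t ≤ lam ω'} (fun _ => Ppeak) ω ∂P := by
  set Pstar : Ω → ℝ := Set.indicator {ω' | t ≤ lam ω'} (fun _ => Ppeak) with hPstar
  have hS : MeasurableSet {ω' | t ≤ lam ω'} := measurableSet_le measurable_const hlam_meas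
  have hPstar_meas : Measurable Pstar := measurable_const.indicator hS
  have hPbar_norm : ∀ᵐ ω ∂P, ‖Pbar ω‖ ≤ Ppeak := by
    filter_upwards [hPbar_bd] with ω h
    rw [Real.norm_eq_abs, abs_of_nonneg h.1]
    exact h.2
  have hPstar_norm : ∀ᵐ ω ∂P, ‖Pstar ω‖ ≤ Ppeak := by
    refine .of_forall fun ω => (norm_indicator_le_norm_self _ _).trans ?_
    rw [Real.norm_eq_abs, abs_of_pos hPpeak]
  have hPbar_int : Integrable Pbar P := .of_bound hPbar_meas.aestronglyMeasurable Ppeak hPbar_norm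
  have hPstar_int : Integrable Pstar P :=
    .of_bound hPstar_meas.aestronglyMeasurable Ppeak hPstar_norm
  have hlamPbar_int : Integrable (fun ω => lam ω * Pbar ω) P :=
    hlam_int.mul_bdd hPbar_meas.aestronglyMeasurable hPbar_norm
  have hlamPstar_int : Integrable (fun ω => lam ω * Pstar ω) P :=
    hlam_int.mul_bdd hPstar_meas.aestronglyMeasurable hPstar_norm
  have hpoint : ∀ᵐ ω ∂P, lam ω * Pbar ω - t * Pbar ω ≤ lam ω * Pstar ω - t * Pstar ω := by
    filter_upwards [hPbar_bd] with ω h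
    rw [← sub_mul, ← sub_mul]
    by_cases hω : t ≤ lam ω
    · rw [hPstar, Set.indicator_of_mem (show ω ∈ {ω' | t ≤ lam ω'} from hω)]
      exact mul_le_mul_of_nonneg_left h.2 (sub_nonneg.2 hω)
    · rw [hPstar, Set.indicator_of_notMem (show ω ∉ {ω' | t ≤ lam ω'} from hω), mul_zero]
      exact mul_nonpos_of_nonpos_of_nonneg (by linarith) h.1
  have hmono := integral_mono_ae (hlamPbar_int.sub (hPbar_int.const_mul t))
    (hlamPstar_int.sub (hPstar_int.const_mul t)) hpoint
  simp only [Pi.sub_apply] at hmono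
  rw [integral_sub hlamPbar_int (hPbar_int.const_mul t),
    integral_sub hlamPstar_int (hPstar_int.const_mul t),
    integral_const_mul, integral_const_mul] at hmono
  linarith [mul_le_mul_of_nonneg_left havg ht]
end

section
/- Let (Ω, F, P) be a probability space, λ : Ω → ℝ a nonnegative integrable random variable, P_peak > 0 and t ≥ 0, and set P* := P_peak · 1{λ ≥ t}. Then for every measurable P̄ : Ω → ℝ with 0 ≤ P̄(ω) ≤ P_peak almost everywhere (no constraint on its mean), the following inequality holds: E[λ · P̄] − E[λ · P*] ≤ t · (E[P̄] − E[P*]). (Key chain of inequalities in the proof of Theorem 1: on the event {λ ≥ t} one has λ(P̄ − P_peak) ≤ t(P̄ − P_peak) since P̄ ≤ P_peak, and on {λ < t} one has λP̄ ≤ tP̄.) -/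
open MeasureTheory

/-- Key chain of inequalities in the proof of Theorem 1: for any power level
`P̄` with `0 ≤ P̄ ≤ P_peak` a.e., and the threshold policy
`P* = P_peak · 1{λ ≥ t}`, one has `E[λ·P̄] − E[λ·P*] ≤ t·(E[P̄] − E[P*])`. -/
theorem stmt_2 {Ω : Type*} [MeasurableSpace Ω] (P : Measure Ω) [IsProbabilityMeasure P]
    (lam : Ω → ℝ) (hlam_meas : Measurable lam) (hlam_nonneg : ∀ ω, 0 ≤ lam ω)
    (hlam_int : Integrable lam P)
    (Ppeak t : ℝ) (hPpeak : 0 < Ppeak) (ht : 0 ≤ t)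
    (Pbar : Ω → ℝ) (hPbar_meas : Measurable Pbar)
    (hPbar_bd : ∀ᵐ ω ∂P, 0 ≤ Pbar ω ∧ Pbar ω ≤ Ppeak) :
    (∫ ω, lam ω * Pbar ω ∂P)
        - ∫ ω, lam ω * Set.indicator {ω' | t ≤ lam ω'} (fun _ => Ppeak) ω ∂P
      ≤ t * ((∫ ω, Pbar ω ∂P)
        - ∫ ω, Set.indicator {ω' | t ≤ lam ω'} (fun _ => Ppeak) ω ∂P) := by
  set Pstar : Ω → ℝ := Set.indicator {ω' | t ≤ lam ω'} (fun _ => Ppeak) with hPstar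
  have hset : MeasurableSet {ω' | t ≤ lam ω'} := measurableSet_le measurable_const hlam_meas
  have hPstar_meas : Measurable Pstar := measurable_const.indicator hset
  have hPbar_norm : ∀ᵐ ω ∂P, ‖Pbar ω‖ ≤ Ppeak := by
    filter_upwards [hPbar_bd] with ω h
    rw [Real.norm_of_nonneg h.1]
    exact h.2
  have hPstar_norm : ∀ᵐ ω ∂P, ‖Pstar ω‖ ≤ Ppeak := by
    refine Filter.Eventually.of_forall fun ω => ?_
    refine (norm_indicator_le_norm_self _ ω).trans ?_
    rw [Real.norm_of_nonneg hPpeak.le]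
  have hPbar_int : Integrable Pbar P :=
    .of_bound hPbar_meas.aestronglyMeasurable Ppeak hPbar_norm
  have hPstar_int : Integrable Pstar P :=
    .of_bound hPstar_meas.aestronglyMeasurable Ppeak hPstar_norm
  have hlamPbar_int : Integrable (fun ω => lam ω * Pbar ω) P :=
    hlam_int.mul_bdd hPbar_meas.aestronglyMeasurable hPbar_norm
  have hlamPstar_int : Integrable (fun ω => lam ω * Pstar ω) P :=
    hlam_int.mul_bdd hPstar_meas.aestronglyMeasurable hPstar_norm
  rw [← integral_sub hlamPbar_int hlamPstar_int, ← integral_sub hPbar_int hPstar_int,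
    ← integral_const_mul]
  refine integral_mono_ae (hlamPbar_int.sub hlamPstar_int)
    ((hPbar_int.sub hPstar_int).const_mul t) ?_
  filter_upwards [hPbar_bd] with ω ⟨h0, h1⟩
  by_cases h : t ≤ lam ω
  · have hω : Pstar ω = Ppeak := Set.indicator_of_mem (s := {ω' | t ≤ lam ω'}) h _
    rw [hω]
    nlinarith
  · have hω : Pstar ω = 0 := Set.indicator_of_notMem (s := {ω' | t ≤ lam ω'}) h _
    rw [hω]
    nlinarith
end

section
/- Let W_1, …, W_K ∈ ℂ^{N×N} be Hermitian positive semidefinite matrices and W' := W_1 + ⋯ + W_K. Let Z ≥ 0, V > 0, P_peak > 0 and P_avg ∈ ℝ. Define x* ∈ ℂ^N by x* := √P_peak · u, where u is a unit-norm eigenvector of W' for λ_max(W'), if λ_max(W') ≥ Z/V, and x* := 0 otherwise. Then x* minimizes the drift-plus-penalty objective f(x) := −V · x^H W' x + Z · (‖x‖² − P_avg) over all x ∈ ℂ^N with ‖x‖² ≤ P_peak. (This is the per-timeslot subproblem solved by Algorithm 1, establishing that its beamforming rule minimizes the right-hand side of the drift-plus-penalty bound in each timeslot.) -/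
open Matrix
open scoped ComplexOrder

theorem star_dotProduct_self_eq_sum_norm_sq {n : Type*} [Fintype n] (x : n → ℂ) :
    star x ⬝ᵥ x = ((∑ i, ‖x i‖ ^ 2 : ℝ) : ℂ) := by
  simp [dotProduct, Complex.conj_mul']

/-- The Rayleigh quotient bound for an upper bound of the eigenvalues. -/
theorem Matrix.IsHermitian.re_star_dotProduct_mulVec_le {n : Type*} [Fintype n] [DecidableEq n]
    {A : Matrix n n ℂ} (hA : A.IsHermitian) {c : ℝ} (hc : ∀ i, hA.eigenvalues i ≤ c)
    (x : n → ℂ) : (star x ⬝ᵥ A *ᵥ x).re ≤ c * ∑ i, ‖x i‖ ^ 2 := by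
  have h_psd : ((c : ℂ) • (1 : Matrix n n ℂ) - A).PosSemidef := by
    have h_diag : (diagonal fun i => (c : ℂ) - hA.eigenvalues i).PosSemidef := by
      refine PosSemidef.diagonal fun i => ?_
      simpa using hc i
    have h_conj := h_diag.mul_mul_conjTranspose_same (hA.eigenvectorUnitary : Matrix n n ℂ)
    convert h_conj using 1
    have h_unit : (hA.eigenvectorUnitary : Matrix n n ℂ) *
        (hA.eigenvectorUnitary : Matrix n n ℂ)ᴴ = 1 :=
      Unitary.mul_star_self_of_mem hA.eigenvectorUnitary.2
    have h_split : (diagonal fun i => (c : ℂ) - hA.eigenvalues i) =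
        (c : ℂ) • (1 : Matrix n n ℂ) - diagonal (RCLike.ofReal ∘ hA.eigenvalues) := by
      ext i j
      by_cases h : i = j <;> simp [h, diagonal]
    rw [h_split, mul_sub, sub_mul, Matrix.mul_smul, mul_one, smul_mul_assoc, h_unit]
    congr 1
    conv_lhs => rw [hA.spectral_theorem]
    rfl
  have h_nonneg := (Complex.le_def.mp (h_psd.dotProduct_mulVec_nonneg x)).1
  rw [sub_mulVec, smul_mulVec, one_mulVec, dotProduct_sub, dotProduct_smul] at h_nonneg
  rw [star_dotProduct_self_eq_sum_norm_sq] at h_nonneg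
  simp only [smul_eq_mul, Complex.sub_re, Complex.re_ofReal_mul, Complex.ofReal_re,
    Complex.zero_re] at h_nonneg
  linarith

/-- The per-timeslot subproblem of Algorithm 1: the two-level beamforming rule
`x* = √P_peak · u_max(W')` if `λ_max(W') ≥ Z/V`, else `x* = 0`, minimizes the
drift-plus-penalty objective `f(x) = -V·xᴴW'x + Z·(‖x‖² - P_avg)` over the ball
`‖x‖² ≤ P_peak`. -/
theorem stmt_5 (N K : ℕ) (hN : 0 < N)
    (W : Fin K → Matrix (Fin N) (Fin N) ℂ) (hW : ∀ i, (W i).PosSemidef)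
    (W' : Matrix (Fin N) (Fin N) ℂ) (hW'def : W' = ∑ i, W i)
    (hW' : W'.IsHermitian)
    (Z V Ppeak Pavg : ℝ) (hZ : 0 ≤ Z) (hV : 0 < V) (hPpeak : 0 < Ppeak)
    (u : Fin N → ℂ) (hu_norm : ∑ i, ‖u i‖ ^ 2 = 1)
    (hu_eig : W' *ᵥ u = (((⨆ i, hW'.eigenvalues i : ℝ)) : ℂ) • u)
    (xstar : Fin N → ℂ)
    (hxstar : xstar = if Z / V ≤ ⨆ i, hW'.eigenvalues i
        then (Real.sqrt Ppeak : ℂ) • u else 0) :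
    (∑ i, ‖xstar i‖ ^ 2 ≤ Ppeak) ∧
    ∀ x : Fin N → ℂ, ∑ i, ‖x i‖ ^ 2 ≤ Ppeak →
      -V * (star xstar ⬝ᵥ W' *ᵥ xstar).re + Z * ((∑ i, ‖xstar i‖ ^ 2) - Pavg)
        ≤ -V * (star x ⬝ᵥ W' *ᵥ x).re + Z * ((∑ i, ‖x i‖ ^ 2) - Pavg) := by
  have h_le := hW'.re_star_dotProduct_mulVec_le
    (le_ciSup (Set.finite_range hW'.eigenvalues).bddAbove)
  set c := ⨆ i, hW'.eigenvalues i
  have h_lower (x : Fin N → ℂ) :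
      (Z - V * c) * ∑ i, ‖x i‖ ^ 2 ≤
        -V * (star x ⬝ᵥ W' *ᵥ x).re + Z * ∑ i, ‖x i‖ ^ 2 := by
    nlinarith [mul_le_mul_of_nonneg_left (h_le x) hV.le]
  split_ifs at hxstar with h
  · have h_norm : ∑ i, ‖xstar i‖ ^ 2 = Ppeak := by
      simp [hxstar, mul_pow, ← Finset.mul_sum, hu_norm, Real.sq_sqrt hPpeak.le]
    have h_eig : W' *ᵥ xstar = (c : ℂ) • xstar := by
      rw [hxstar, mulVec_smul, hu_eig, smul_comm]
    have h_val : (star xstar ⬝ᵥ W' *ᵥ xstar).re = c * Ppeak := by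
      rw [h_eig, dotProduct_smul, star_dotProduct_self_eq_sum_norm_sq, h_norm, smul_eq_mul,
        Complex.re_ofReal_mul, Complex.ofReal_re]
    refine ⟨h_norm.le, fun x hx => ?_⟩
    have h_coef : Z - V * c ≤ 0 := by
      rw [div_le_iff₀ hV] at h
      linarith
    rw [h_val, h_norm]
    nlinarith [h_lower x, mul_le_mul_of_nonpos_left hx h_coef]
  · subst hxstar
    refine ⟨by simpa using hPpeak.le, fun x _ => ?_⟩
    have h_coef : 0 ≤ Z - V * c := by
      rw [not_le, lt_div_iff₀ hV] at h
      linarith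
    have h_zero : -V * (star (0 : Fin N → ℂ) ⬝ᵥ W' *ᵥ 0).re +
        Z * ((∑ i, ‖(0 : Fin N → ℂ) i‖ ^ 2) - Pavg) = -(Z * Pavg) := by simp
    rw [h_zero]
    have h_sum : 0 ≤ ∑ i, ‖x i‖ ^ 2 := Finset.sum_nonneg fun i _ => sq_nonneg _
    nlinarith [h_lower x, mul_nonneg h_coef h_sum]
end

section
/- Consider the virtual queue process generated by Algorithm 1: let V > 0, P_peak > 0, P_avg ≥ 0, and Λ ≥ 0; let λ : ℕ → ℝ satisfy 0 ≤ λ(l) ≤ Λ for all l; set Z(0) = 0, define the transmit power p(l) := P_peak if λ(l) ≥ Z(l)/V and p(l) := 0 otherwise, and update Z(l+1) := max(Z(l) + p(l) − P_avg, 0). Then the virtual queue is deterministically bounded: Z(l) ≤ V·Λ + P_peak for every l ∈ ℕ. -/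
/-- Deterministic boundedness of the virtual queue generated by Algorithm 1:
`Z l ≤ V·Λ + P_peak` for all `l`. -/
theorem stmt_9 (V Ppeak Pavg Lam : ℝ) (hV : 0 < V) (hPpeak : 0 < Ppeak)
    (hPavg : 0 ≤ Pavg) (hLam : 0 ≤ Lam)
    (lam : ℕ → ℝ) (hlam : ∀ l, 0 ≤ lam l ∧ lam l ≤ Lam)
    (Z p : ℕ → ℝ) (hZ0 : Z 0 = 0)
    (hp : ∀ l, p l = if Z l / V ≤ lam l then Ppeak else 0)
    (hZ : ∀ l, Z (l + 1) = max (Z l + p l - Pavg) 0) :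
    ∀ l, Z l ≤ V * Lam + Ppeak := by
  have hbound : 0 ≤ V * Lam + Ppeak := by positivity
  intro l
  induction l with
  | zero => rw [hZ0]; exact hbound
  | succ l ih =>
    rw [hZ l, hp l]
    refine max_le ?_ hbound
    split_ifs with h
    · have hZl : Z l ≤ Lam * V := (div_le_iff₀ hV).mp (h.trans (hlam l).2)
      linarith
    · linarith
end

section
/- Let H ∈ ℂ^{m×n} have singular value decomposition H = U Θ V^H with positive singular values θ_1, …, θ_r (r = rank(H)) and corresponding orthonormal right singular vectors v_1, …, v_r ∈ ℂ^n, and let δ > 0. Define the water-filling covariance S* := Σ_{j=1}^r ψ_j · v_j v_j^H, where ψ_j := max(0, 1 − δ/θ_j²). Then for every Hermitian positive semidefinite S ∈ ℂ^{n×n}, log det(I_m + (1/δ)·H S H^H) − Tr(S) ≤ log det(I_m + (1/δ)·H S* H^H) − Tr(S*); that is, S* maximizes log det(I_m + (1/δ)·H S H^H) − Tr(S) over all Hermitian positive semidefinite matrices S. (This is the per-timeslot optimal uplink covariance in Algorithm 3, equation (55)–(56) in the proof of Theorem 4.) -/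
open Matrix
open scoped ComplexOrder

/-- The trace inequality `log det B ≤ Tr B - card n` for positive definite `B`. -/
lemma log_det_le_trace_sub_card {n : Type*} [Fintype n] [DecidableEq n]
    {B : Matrix n n ℂ} (hB : B.PosDef) :
    Real.log B.det.re ≤ B.trace.re - Fintype.card n := by
  have hdet : B.det.re = ∏ i, hB.isHermitian.eigenvalues i := by
    rw [hB.isHermitian.det_eq_prod_eigenvalues]
    norm_cast
  have htr : B.trace.re = ∑ i, hB.isHermitian.eigenvalues i := by
    rw [hB.isHermitian.trace_eq_sum_eigenvalues]
    norm_cast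
  rw [hdet, htr, Real.log_prod fun i _ => (hB.eigenvalues_pos i).ne']
  calc ∑ i, Real.log (hB.isHermitian.eigenvalues i)
      ≤ ∑ i, (hB.isHermitian.eigenvalues i - 1) :=
        Finset.sum_le_sum fun i _ => Real.log_le_sub_one_of_pos (hB.eigenvalues_pos i)
    _ = _ := by simp

/-- The tangent-plane bound for `log det` at a positive diagonal matrix. -/
lemma log_det_le_sum_log_add {n : Type*} [Fintype n] [DecidableEq n]
    {A : Matrix n n ℂ} (hA : A.PosDef) {d : n → ℝ} (hd : ∀ i, 0 < d i) :
    Real.log A.det.re ≤ ∑ i, Real.log (d i) + ∑ i, ((A i i).re / d i - 1) := by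
  set e : n → ℝ := fun i => (Real.sqrt (d i))⁻¹ with he
  have he0 (i : n) : 0 < e i := inv_pos.2 (Real.sqrt_pos.2 (hd i))
  have hesq (i : n) : e i * e i = (d i)⁻¹ := by
    rw [he, ← mul_inv, Real.mul_self_sqrt (hd i).le]
  set E : Matrix n n ℂ := diagonal fun i => (e i : ℂ) with hE
  have hEH : Eᴴ = E := by
    rw [hE, diagonal_conjTranspose]
    congr 1
    ext i
    simp
  have hEdet : E.det = ((∏ i, e i : ℝ) : ℂ) := by simp [hE]
  have hEu : IsUnit E := by
    rw [isUnit_iff_isUnit_det, hEdet, isUnit_iff_ne_zero]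
    exact_mod_cast (Finset.prod_pos fun i _ => he0 i).ne'
  have hB : (E * A * E).PosDef := by
    have := hA.conjTranspose_mul_mul_same (B := E) (mulVec_injective_of_isUnit hEu)
    rwa [hEH] at this
  have hAdet : 0 < A.det.re := (Complex.pos_iff.1 hA.det_pos).1
  have hdet : (E * A * E).det.re = (∏ i, (d i)⁻¹) * A.det.re := by
    rw [det_mul, det_mul, hEdet, mul_right_comm, ← Complex.ofReal_mul, Complex.re_ofReal_mul,
      ← Finset.prod_mul_distrib]
    simp_rw [hesq]
  have htr : (E * A * E).trace.re = ∑ i, (A i i).re / d i := by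
    rw [trace, Complex.re_sum]
    refine Finset.sum_congr rfl fun i _ => ?_
    rw [diag_apply, hE, mul_diagonal, diagonal_mul, mul_right_comm, ← Complex.ofReal_mul,
      Complex.re_ofReal_mul, hesq, div_eq_inv_mul]
  have key := log_det_le_trace_sub_card hB
  rw [hdet, htr, Real.log_mul (Finset.prod_pos fun i _ => inv_pos.2 (hd i)).ne' hAdet.ne',
    Real.log_prod fun i _ => (inv_pos.2 (hd i)).ne'] at key
  simp only [Real.log_inv, Finset.sum_neg_distrib] at key
  simp only [Finset.sum_sub_distrib, Finset.sum_const, Finset.card_univ, nsmul_eq_mul, mul_one]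
  linarith

/-- Compressing a positive semidefinite matrix to the span of orthonormal columns does not
increase its trace. -/
lemma trace_conjTranspose_mul_mul_le {n k : Type*} [Fintype n] [DecidableEq n]
    [Fintype k] [DecidableEq k] {S : Matrix n n ℂ} (hS : S.PosSemidef)
    {V : Matrix n k ℂ} (hV : Vᴴ * V = 1) :
    (Vᴴ * S * V).trace.re ≤ S.trace.re := by
  set P : Matrix n n ℂ := 1 - V * Vᴴ with hP
  have hPH : Pᴴ = P := by simp [hP]
  have hPP : P * P = P := by
    have : V * Vᴴ * (V * Vᴴ) = V * Vᴴ := by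
      rw [Matrix.mul_assoc, ← Matrix.mul_assoc Vᴴ, hV, Matrix.one_mul]
    rw [hP, sub_mul, Matrix.one_mul, mul_sub, this, Matrix.mul_one, sub_self, sub_zero]
  have h0 := (Complex.nonneg_iff.1 (hS.conjTranspose_mul_mul_same P).trace_nonneg).1
  have h1 : (Pᴴ * S * P).trace = S.trace - (Vᴴ * S * V).trace := by
    rw [trace_mul_comm, ← Matrix.mul_assoc, hPH, hPP, hP, sub_mul, trace_sub, Matrix.one_mul,
      Matrix.mul_assoc V, trace_mul_comm V]
  rw [h1, Complex.sub_re] at h0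
  linarith

/-- A weighted sum of rank-one matrices, as a product with a diagonal middle factor. -/
lemma sum_smul_vecMulVec_star {m n k : Type*} [Fintype k] [DecidableEq k]
    (c : k → ℂ) (u : k → m → ℂ) (v : k → n → ℂ) :
    ∑ j, c j • vecMulVec (u j) (star (v j)) = (of u)ᵀ * diagonal c * ((of v)ᵀ)ᴴ := by
  ext a b
  rw [Matrix.sum_apply, mul_apply]
  simp only [Matrix.smul_apply, vecMulVec_apply, mul_diagonal, transpose_apply,
    of_apply, conjTranspose_apply, Pi.star_apply, smul_eq_mul]
  exact Finset.sum_congr rfl fun j _ => by ring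

/-- Orthonormality of a family of vectors, as an identity for the matrix with these columns. -/
lemma conjTranspose_mul_self_of_orthonormal {n k : Type*} [Fintype n] [DecidableEq k]
    {v : k → n → ℂ} (hv : ∀ i j, star (v i) ⬝ᵥ v j = if i = j then (1 : ℂ) else 0) :
    ((of v)ᵀ)ᴴ * (of v)ᵀ = 1 := by
  ext i j
  simpa [mul_apply, dotProduct, one_apply] using hv i j

/-- The determinant `det (1 + δ⁻¹ H S Hᴴ)` reduces to the row space of `H`. -/
lemma det_one_add_smul_svd {m n k : Type*} [Fintype m] [DecidableEq m] [Fintype n]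
    [Fintype k] [DecidableEq k] {U : Matrix m k ℂ} (hU : Uᴴ * U = 1) (D : Matrix k k ℂ)
    (V : Matrix n k ℂ) (δ : ℝ) (S : Matrix n n ℂ) :
    (1 + δ⁻¹ • ((U * D * Vᴴ) * S * (U * D * Vᴴ)ᴴ)).det =
      (1 + δ⁻¹ • (D * (Vᴴ * S * V) * Dᴴ)).det := by
  have h : δ⁻¹ • ((U * D * Vᴴ) * S * (U * D * Vᴴ)ᴴ) =
      U * (δ⁻¹ • (D * (Vᴴ * S * V) * Dᴴ) * Uᴴ) := by
    simp only [conjTranspose_mul, conjTranspose_conjTranspose, Matrix.mul_assoc,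
      Matrix.smul_mul, Matrix.mul_smul]
  rw [h, det_one_add_mul_comm, Matrix.mul_assoc, hU, Matrix.mul_one]

/-- Optimality of the water-filling covariance (per-timeslot optimal uplink
covariance in Algorithm 3, equations (55)–(56)): if `H = Σⱼ θⱼ uⱼ vⱼᴴ` is a
(compact) SVD of `H` with positive singular values `θⱼ` and orthonormal
left/right singular vectors `uⱼ`, `vⱼ` (`r = rank H`), and `δ > 0`, then
`S* = Σⱼ ψⱼ vⱼ vⱼᴴ` with `ψⱼ = max(0, 1 − δ/θⱼ²)` maximizes
`log det(I + (1/δ)·H S Hᴴ) − Tr(S)` over all Hermitian positive semidefinite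
matrices `S`. -/
theorem stmt_15 (m n r : ℕ)
    (H : Matrix (Fin m) (Fin n) ℂ)
    (θ : Fin r → ℝ) (hθ : ∀ j, 0 < θ j)
    (u : Fin r → Fin m → ℂ) (v : Fin r → Fin n → ℂ)
    (hu : ∀ j k, star (u j) ⬝ᵥ u k = if j = k then (1 : ℂ) else 0)
    (hv : ∀ j k, star (v j) ⬝ᵥ v k = if j = k then (1 : ℂ) else 0)
    (hH : H = ∑ j, (θ j : ℂ) • Matrix.vecMulVec (u j) (star (v j)))
    (hr : H.rank = r)
    (δ : ℝ) (hδ : 0 < δ)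
    (ψ : Fin r → ℝ) (hψ : ∀ j, ψ j = max 0 (1 - δ / θ j ^ 2))
    (Sstar : Matrix (Fin n) (Fin n) ℂ)
    (hSstar : Sstar = ∑ j, (ψ j : ℂ) • Matrix.vecMulVec (v j) (star (v j)))
    (S : Matrix (Fin n) (Fin n) ℂ) (hS : S.PosSemidef) :
    Real.log ((1 + δ⁻¹ • (H * S * Hᴴ)).det).re - S.trace.re
      ≤ Real.log ((1 + δ⁻¹ • (H * Sstar * Hᴴ)).det).re - Sstar.trace.re := by
  set U : Matrix (Fin m) (Fin r) ℂ := (of u)ᵀ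
  set V : Matrix (Fin n) (Fin r) ℂ := (of v)ᵀ
  set D : Matrix (Fin r) (Fin r) ℂ := diagonal fun j => (θ j : ℂ) with hD
  have hU : Uᴴ * U = 1 := conjTranspose_mul_self_of_orthonormal hu
  have hV : Vᴴ * V = 1 := conjTranspose_mul_self_of_orthonormal hv
  have hDH : Dᴴ = D := by
    rw [hD, diagonal_conjTranspose]
    congr 1
    ext i
    simp
  rw [sum_smul_vecMulVec_star] at hH hSstar
  have hVS : Vᴴ * Sstar * V = diagonal fun j => (ψ j : ℂ) := by
    rw [hSstar]
    calc Vᴴ * (V * diagonal (fun j => (ψ j : ℂ)) * Vᴴ) * V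
        = (Vᴴ * V) * diagonal (fun j => (ψ j : ℂ)) * (Vᴴ * V) := by
          simp only [Matrix.mul_assoc]
      _ = _ := by rw [hV, Matrix.one_mul, Matrix.mul_one]
  have htrS : Sstar.trace.re = ∑ j, ψ j := by
    rw [hSstar, trace_mul_comm, ← Matrix.mul_assoc, hV, Matrix.one_mul, trace_diagonal,
      Complex.re_sum]
    simp
  have hψ0 (j : Fin r) : 0 ≤ ψ j := hψ j ▸ le_max_left _ _
  set d : Fin r → ℝ := fun j => 1 + δ⁻¹ * (θ j * ψ j * θ j) with hd
  have hd0 (j : Fin r) : 0 < d j := by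
    have := hψ0 j
    have := hθ j
    positivity
  have hdetS : (1 + δ⁻¹ • (H * Sstar * Hᴴ)).det.re = ∏ j, d j := by
    rw [hH, det_one_add_smul_svd hU, hVS, hDH, hD, diagonal_mul_diagonal, diagonal_mul_diagonal,
      ← diagonal_smul, ← diagonal_one, diagonal_add, det_diagonal]
    rw [← Complex.ofReal_re (∏ j, d j), Complex.ofReal_prod]
    simp [hd]
  set T : Matrix (Fin r) (Fin r) ℂ := Vᴴ * S * V
  have hTps : T.PosSemidef := hS.conjTranspose_mul_mul_same V
  have hA : (1 + δ⁻¹ • (D * T * Dᴴ)).PosDef :=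
    PosDef.one.add_posSemidef ((hTps.mul_mul_conjTranspose_same D).smul (inv_pos.2 hδ).le)
  have hAjj (j : Fin r) :
      ((1 + δ⁻¹ • (D * T * Dᴴ)) j j).re = 1 + δ⁻¹ * (θ j ^ 2 * (T j j).re) := by
    rw [hDH, Matrix.add_apply, one_apply_eq, Matrix.smul_apply, hD, mul_diagonal, diagonal_mul,
      mul_right_comm, ← Complex.ofReal_mul, Complex.add_re, Complex.smul_re,
      Complex.re_ofReal_mul, Complex.one_re, smul_eq_mul, pow_two]
  have hbound (j : Fin r) :
      (1 + δ⁻¹ * (θ j ^ 2 * (T j j).re)) / d j - 1 ≤ (T j j).re - ψ j := by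
    have ht : 0 ≤ (T j j).re := (Complex.nonneg_iff.1 hTps.diag_nonneg).1
    have hθj := hθ j
    rw [sub_le_iff_le_add, div_le_iff₀ (hd0 j)]
    rcases le_total (1 - δ / θ j ^ 2) 0 with h | h
    · have hz : ψ j = 0 := by rw [hψ j, max_eq_left h]
      have h1 : δ⁻¹ * θ j ^ 2 ≤ 1 := by
        rw [sub_nonpos, one_le_div (by positivity)] at h
        rwa [inv_mul_le_iff₀ hδ, mul_one]
      simp only [hd, hz]
      nlinarith [mul_le_mul_of_nonneg_right h1 ht]
    · have hp : ψ j = 1 - δ / θ j ^ 2 := by rw [hψ j, max_eq_right h]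
      simp only [hd, hp]
      apply le_of_eq
      field_simp
      ring
  have htr : ∑ j, (T j j).re ≤ S.trace.re := by
    have := trace_conjTranspose_mul_mul_le hS hV
    rwa [trace, Complex.re_sum] at this
  have hmain := log_det_le_sum_log_add hA hd0
  simp only [hAjj] at hmain
  have hsum := Finset.sum_le_sum fun j (_ : j ∈ Finset.univ) => hbound j
  rw [Finset.sum_sub_distrib (fun j => (T j j).re)] at hsum
  rw [hdetS, htrS, Real.log_prod fun j _ => (hd0 j).ne', hH, det_one_add_smul_svd hU]
  linarith
end
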